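/- arXiv:1411.3012 — 11 statements merged into one kernel-verified Lean document; each statement's English description precedes it below -/
import Mathlib

section
/- Let (F_i)_{i∈ℕ} be a nondecreasing sequence of closed subsets of U and (K_j)_{j∈ℕ} a nondecreasing sequence of compact subsets of U whose interiors cover U. Then the bipolar of the family {F_i : i ∈ ℕ} is {F closed in U : ∃ i ∈ ℕ, F ⊆ F_i ∪ K_i}, and the polar of {F_i : i ∈ ℕ} is {O open in U : ∀ i ∈ ℕ, ∃ k ∈ ℕ, O ⊆ (U∖F_i) ∪ K_k}. -/
open Set Metric

section Defs

variable {X : Type*} [MetricSpace X]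

/-- `V` is open in the subspace topology of `U`. -/
def IsOpenIn (U V : Set X) : Prop := ∃ W, IsOpen W ∧ V = W ∩ U

/-- `C` is closed in the subspace topology of `U`. -/
def IsClosedIn (U C : Set X) : Prop := ∃ F, IsClosed F ∧ C = F ∩ U

/-- Closure of `C` in the subspace topology of `U` (for `C ⊆ U`). -/
def closureIn (U C : Set X) : Set X := closure C ∩ U

/-- Interior of `S` in the subspace topology of `U`. -/
def interiorIn (U S : Set X) : Set X := U \ closure (U \ S)

/-- Polar of a family `𝓞` of open subsets of `U`:  closed subsets of `U` whose intersection with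
every member of `𝓞` has compact closure in `U`. -/
def polarO (U : Set X) (𝓞 : Set (Set X)) : Set (Set X) :=
  {C | IsClosedIn U C ∧ ∀ W ∈ 𝓞, IsCompact (closureIn U (C ∩ W))}

/-- Polar of a family `𝓒` of closed subsets of `U`: open subsets of `U` whose intersection with
every member of `𝓒` has compact closure in `U`. -/
def polarC (U : Set X) (𝓒 : Set (Set X)) : Set (Set X) :=
  {V | IsOpenIn U V ∧ ∀ C ∈ 𝓒, IsCompact (closureIn U (V ∩ C))}

/-- `𝓞_𝓒`: the family of relative interiors of members of `𝓒`. -/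
def oFam (U : Set X) (𝓒 : Set (Set X)) : Set (Set X) := interiorIn U '' 𝓒

/-- `𝓒_𝓞`: the family of relative closures of members of `𝓞`. -/
def cFam (U : Set X) (𝓞 : Set (Set X)) : Set (Set X) := closureIn U '' 𝓞

/-- Uniform `ε`-enlargement of `C ⊆ U`:
`C_{uε} = {x ∈ U : ∃ y ∈ C, d(x,y) ≤ min(ε, d(y,M∖U)·(1−e^{−ε})/2)}`, where the distance to the
(possibly empty) complement of `U` is taken in `[0,∞]`. -/
def uEnl (U C : Set X) (ε : ℝ) : Set X :=
  {x | x ∈ U ∧ ∃ y ∈ C, dist x y ≤ ε ∧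
    ENNReal.ofReal (dist x y) ≤ EMetric.infEdist y Uᶜ * ENNReal.ofReal ((1 - Real.exp (-ε)) / 2)}

/-- A family of closed subsets of `U` is uniformly enlargeable if each member has some uniform
`ε`-enlargement in the family. -/
def UniformlyEnlargeable (U : Set X) (𝓒 : Set (Set X)) : Prop :=
  ∀ C ∈ 𝓒, ∃ ε : ℝ, 0 < ε ∧ uEnl U C ε ∈ 𝓒

/-- The cover-dependent `ε`-enlargement `C_ε = ⋃ᵢ cl(Uᵢ) ∩ (cl(Uᵢ) ∩ C)_{uεᵢ}`. -/
def coverEnl {I : Type*} (Ui : I → Set X) (U C : Set X) (ε : I → ℝ) : Set X :=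
  ⋃ i, closure (Ui i) ∩ uEnl U (closure (Ui i) ∩ C) (ε i)

/-- The cover-dependent enlargement `C_{wε} = ⋃ᵢ (cl(Uᵢ) ∩ C)_{uεᵢ}`. -/
def coverWEnl {I : Type*} (Ui : I → Set X) (U C : Set X) (ε : I → ℝ) : Set X :=
  ⋃ i, uEnl U (closure (Ui i) ∩ C) (ε i)

/-- A family of closed subsets of `U` is enlargeable with respect to the cover `Ui` if each
member has some cover-enlargement in the family. -/
def Enlargeable {I : Type*} (Ui : I → Set X) (U : Set X) (𝓒 : Set (Set X)) : Prop :=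
  ∀ C ∈ 𝓒, ∃ ε : I → ℝ, (∀ i, 0 < ε i) ∧ coverEnl Ui U C ε ∈ 𝓒

/-- A cover of `U` by open sets with compact closures contained in `U`, locally finite in `U`. -/
structure GoodCover {I : Type*} (Ui : I → Set X) (U : Set X) : Prop where
  isOpen : ∀ i, IsOpen (Ui i)
  covers : U ⊆ ⋃ i, Ui i
  compactCl : ∀ i, IsCompact (closure (Ui i))
  clSubset : ∀ i, closure (Ui i) ⊆ U
  locFin : ∀ x ∈ U, ∃ t ∈ nhds x, {i | (closure (Ui i) ∩ t).Nonempty}.Finite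

/-- `δ(t) = ln((1+e^{−t})/(3e^{−t}−1))`. -/
noncomputable def deltaFn (t : ℝ) : ℝ :=
  Real.log ((1 + Real.exp (-t)) / (3 * Real.exp (-t) - 1))

end Defs

theorem key_aux {X : Type*} [MetricSpace X]
    (U : Set X) (hU : IsOpen U)
    (K : ℕ → Set X) (hKcpt : ∀ j, IsCompact (K j)) (hKU : ∀ j, K j ⊆ U)
    (hKmono : Monotone K) (hKcover : U ⊆ ⋃ j, interiorIn U (K j)) (S : Set X) (hS : S ⊆ U) :
    IsCompact (closureIn U S) ↔ ∃ k, S ⊆ K k := by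
  have hsub : ∀ k, interiorIn U (K k) ⊆ K k := by
    intro k x hx
    by_contra h
    exact hx.2 (subset_closure ⟨hx.1, h⟩)
  constructor
  · intro h
    obtain ⟨k, hk⟩ := h.elim_directed_cover (fun j => interiorIn U (K j))
      (fun j => hU.sdiff isClosed_closure) (fun x hx => hKcover hx.2)
      (Monotone.directed_le (fun a b hab x hx =>
        ⟨hx.1, fun hc => hx.2 (closure_mono (diff_subset_diff_right (hKmono hab)) hc)⟩))
    exact ⟨k, fun x hx => hsub k (hk ⟨subset_closure hx, hS hx⟩)⟩
  · rintro ⟨k, hk⟩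
    have h1 : closure S ⊆ K k := closure_minimal hk (hKcpt k).isClosed
    have h2 : closureIn U S = closure S := inter_eq_left.2 (h1.trans (hKU k))
    rw [h2]
    exact (hKcpt k).of_isClosed_subset isClosed_closure h1

/-- countably generated families of closed sets: bipolar and polar formulas. -/
theorem stmt0 {X : Type*} [MetricSpace X] [ProperSpace X]
    (U : Set X) (hU : IsOpen U)
    (F : ℕ → Set X) (hFcl : ∀ i, IsClosedIn U (F i)) (hFmono : Monotone F)
    (K : ℕ → Set X) (hKcpt : ∀ j, IsCompact (K j)) (hKU : ∀ j, K j ⊆ U)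
    (hKmono : Monotone K) (hKcover : U ⊆ ⋃ j, interiorIn U (K j)) :
    polarO U (polarC U (Set.range F)) =
      {C | IsClosedIn U C ∧ ∃ i, C ⊆ F i ∪ K i} ∧
    polarC U (Set.range F) =
      {O | IsOpenIn U O ∧ ∀ i, ∃ k, O ⊆ (U \ F i) ∪ K k} := by
  have key := key_aux U hU K hKcpt hKU hKmono hKcover
  have hsub : ∀ k, interiorIn U (K k) ⊆ K k := by
    intro k x hx
    by_contra h
    exact hx.2 (subset_closure ⟨hx.1, h⟩)
  have hpol : polarC U (Set.range F) =
      {O | IsOpenIn U O ∧ ∀ i, ∃ k, O ⊆ (U \ F i) ∪ K k} := by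
    ext O
    refine and_congr_right fun hO => ?_
    have hOU : O ⊆ U := by
      obtain ⟨W, _, rfl⟩ := hO
      exact inter_subset_right
    rw [forall_mem_range]
    refine forall_congr' fun i => ?_
    rw [key _ (inter_subset_left.trans hOU)]
    refine exists_congr fun k => ⟨fun h x hx => ?_, fun h x hx => ?_⟩
    · by_cases hf : x ∈ F i
      · exact Or.inr (h ⟨hx, hf⟩)
      · exact Or.inl ⟨hOU hx, hf⟩
    · rcases h hx.1 with h | h
      · exact absurd hx.2 h.2
      · exact h
  refine ⟨?_, hpol⟩
  rw [hpol]
  ext C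
  refine and_congr_right fun hC => ?_
  have hCU : C ⊆ U := by
    obtain ⟨W, _, rfl⟩ := hC
    exact inter_subset_right
  constructor
  · intro h
    by_contra! hne
    have hne' : ∀ i, ∃ x ∈ C, x ∉ F i ∧ x ∉ K i := by
      intro i
      obtain ⟨x, hx, hx'⟩ := not_subset.1 (hne i)
      exact ⟨x, hx, fun h => hx' (Or.inl h), fun h => hx' (Or.inr h)⟩
    choose x hxC hxF hxK using hne'
    have hcov : ∀ i, ∃ k, x i ∈ interiorIn U (K k) := fun i =>
      mem_iUnion.1 (hKcover (hCU (hxC i)))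
    choose k hk using hcov
    have hop : IsOpen (⋃ j, (U \ F j) ∩ interiorIn U (K (k j))) := by
      refine isOpen_iUnion fun j => IsOpen.inter ?_ (hU.sdiff isClosed_closure)
      obtain ⟨G, hG, hGe⟩ := hFcl j
      have : U \ F j = U \ G := by
        rw [hGe]; ext y; simp
      rw [this]
      exact hU.sdiff hG
    have hWU : (⋃ j, (U \ F j) ∩ interiorIn U (K (k j))) ⊆ U :=
      iUnion_subset fun j y hy => hy.1.1
    have hc := h (⋃ j, (U \ F j) ∩ interiorIn U (K (k j)))
      ⟨⟨_, hop, (inter_eq_left.2 hWU).symm⟩, fun i => by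
        refine ⟨(Finset.range i).sup k, fun y hy => ?_⟩
        obtain ⟨j, hj⟩ := mem_iUnion.1 hy
        by_cases hji : j < i
        · exact Or.inr (hKmono (Finset.le_sup (Finset.mem_range.2 hji)) (hsub _ hj.2))
        · exact Or.inl ⟨hj.1.1, fun hf => hj.1.2 (hFmono (not_lt.1 hji) hf)⟩⟩
    obtain ⟨m, hm⟩ := (key _ (inter_subset_left.trans hCU)).1 hc
    exact hxK m (hm ⟨hxC m, mem_iUnion.2 ⟨m, ⟨hCU (hxC m), hxF m⟩, hk m⟩⟩)
  · rintro ⟨i, hi⟩ W ⟨hW, hWk⟩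
    obtain ⟨k, hk⟩ := hWk i
    refine (key _ (inter_subset_left.trans hCU)).2 ⟨max i k, fun y hy => ?_⟩
    rcases hi hy.1 with h | h
    · rcases hk hy.2 with h' | h'
      · exact absurd h h'.2
      · exact hKmono (le_max_right _ _) h'
    · exact hKmono (le_max_left _ _) h
end

section
/- Let (O_i)_{i∈ℕ} be a nondecreasing sequence of open subsets of U and (K_j)_{j∈ℕ} a nondecreasing sequence of compact subsets of U whose interiors cover U. Then the bipolar of the family {O_i : i ∈ ℕ} is {O open in U : ∃ i ∈ ℕ, O ⊆ O_i ∪ K_i}, and the polar of {O_i : i ∈ ℕ} is {F closed in U : ∀ i ∈ ℕ, ∃ k ∈ ℕ, F ⊆ (U∖O_i) ∪ K_k}. -/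
open Set Metric

theorem aux_int_open {X : Type*} [MetricSpace X] {U : Set X} (hU : IsOpen U) (S : Set X) :
    IsOpen (interiorIn U S) := hU.sdiff isClosed_closure

theorem aux_int_sub {X : Type*} [MetricSpace X] (U S : Set X) : interiorIn U S ⊆ S := by
  intro x hx
  by_contra h
  exact hx.2 (subset_closure ⟨hx.1, h⟩)

theorem aux_int_mono {X : Type*} [MetricSpace X] (U : Set X) {S T : Set X} (h : S ⊆ T) :
    interiorIn U S ⊆ interiorIn U T := by
  intro x hx
  exact ⟨hx.1, fun h' => hx.2 (closure_mono (diff_subset_diff_right h) h')⟩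

theorem aux_cpt {X : Type*} [MetricSpace X] {U : Set X} (hU : IsOpen U)
    {K : ℕ → Set X} (hKcpt : ∀ j, IsCompact (K j)) (hKU : ∀ j, K j ⊆ U)
    (hKmono : Monotone K) (hKcover : U ⊆ ⋃ j, interiorIn U (K j)) {S : Set X} (hS : S ⊆ U) :
    IsCompact (closureIn U S) ↔ ∃ k, S ⊆ K k := by
  constructor
  · intro h
    obtain ⟨k, hk⟩ := h.elim_directed_cover (fun j => interiorIn U (K j))
      (fun j => aux_int_open hU _) (fun x hx => hKcover hx.2)
      (Monotone.directed_le fun a b hab => aux_int_mono U (hKmono hab))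
    exact ⟨k, fun x hx => aux_int_sub _ _ (hk ⟨subset_closure hx, hS hx⟩)⟩
  · rintro ⟨k, hk⟩
    have h1 : closure S ⊆ K k := closure_minimal hk (hKcpt k).isClosed
    have h2 : closureIn U S = closure S :=
      inter_eq_left.2 (h1.trans (hKU k))
    rw [h2]
    exact (hKcpt k).of_isClosed_subset isClosed_closure h1

/-- countably generated families of open sets: bipolar and polar formulas. -/
theorem stmt1 {X : Type*} [MetricSpace X] [ProperSpace X]
    (U : Set X) (hU : IsOpen U)
    (O : ℕ → Set X) (hOop : ∀ i, IsOpenIn U (O i)) (hOmono : Monotone O)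
    (K : ℕ → Set X) (hKcpt : ∀ j, IsCompact (K j)) (hKU : ∀ j, K j ⊆ U)
    (hKmono : Monotone K) (hKcover : U ⊆ ⋃ j, interiorIn U (K j)) :
    polarC U (polarO U (Set.range O)) =
      {V | IsOpenIn U V ∧ ∃ i, V ⊆ O i ∪ K i} ∧
    polarO U (Set.range O) =
      {C | IsClosedIn U C ∧ ∀ i, ∃ k, C ⊆ (U \ O i) ∪ K k} := by
  have key : ∀ {S : Set X}, S ⊆ U → (IsCompact (closureIn U S) ↔ ∃ k, S ⊆ K k) :=
    fun hS => aux_cpt hU hKcpt hKU hKmono hKcover hS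
  have clU : ∀ {C : Set X}, IsClosedIn U C → C ⊆ U := by
    rintro C ⟨F, -, rfl⟩
    exact inter_subset_right
  have opU : ∀ {C : Set X}, IsOpenIn U C → C ⊆ U := by
    rintro C ⟨F, -, rfl⟩
    exact inter_subset_right
  have hpol : ∀ C, C ∈ polarO U (Set.range O) ↔
      IsClosedIn U C ∧ ∀ i, ∃ k, C ∩ O i ⊆ K k := by
    intro C
    constructor
    · rintro ⟨h, h'⟩
      exact ⟨h, fun i => (key (inter_subset_left.trans (clU h))).1 (h' _ ⟨i, rfl⟩)⟩
    · rintro ⟨h, h'⟩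
      refine ⟨h, ?_⟩
      rintro _ ⟨i, rfl⟩
      exact (key (inter_subset_left.trans (clU h))).2 (h' i)
  constructor
  · ext V
    constructor
    · rintro ⟨hV, h⟩
      refine ⟨hV, ?_⟩
      by_contra hcon
      have hx : ∀ i, ∃ x, x ∈ V ∧ x ∉ O i ∧ x ∉ K i := by
        intro i
        by_contra hi
        refine hcon ⟨i, fun x hxV => ?_⟩
        by_contra hx
        exact hi ⟨x, hxV, fun h => hx (Or.inl h), fun h => hx (Or.inr h)⟩
      choose x hxV hxO hxK using hx
      have hxU : ∀ i, x i ∈ U := fun i => opU hV (hxV i)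
      have hC : range x ∈ polarO U (Set.range O) := by
        rw [hpol]
        constructor
        · refine ⟨closure (range x), isClosed_closure, ?_⟩
          apply Subset.antisymm
          · rintro _ ⟨i, rfl⟩
            exact ⟨subset_closure ⟨i, rfl⟩, hxU i⟩
          · rintro y ⟨hy, hyU⟩
            obtain ⟨j, hj⟩ := mem_iUnion.1 (hKcover hyU)
            have h1 : y ∈ closure (interiorIn U (K j) ∩ range x) :=
              (aux_int_open hU (K j)).inter_closure ⟨hj, hy⟩
            have h2 : interiorIn U (K j) ∩ range x ⊆ x '' Iio j := by
              rintro _ ⟨hz, i, rfl⟩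
              refine ⟨i, ?_, rfl⟩
              by_contra hij
              exact hxK i (hKmono (not_lt.1 hij) (aux_int_sub _ _ hz))
            have h3 := closure_minimal h2 ((finite_Iio j).image x).isClosed h1
            exact image_subset_range _ _ h3
        · intro i
          have h2 : range x ∩ O i ⊆ x '' Iio i := by
            rintro _ ⟨⟨j, rfl⟩, hz⟩
            refine ⟨j, ?_, rfl⟩
            by_contra hij
            exact hxO j (hOmono (not_lt.1 hij) hz)
          have hfU : x '' Iio i ⊆ U := by
            rintro _ ⟨j, -, rfl⟩
            exact hxU j
          have hf := (finite_Iio i).image x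
          have hc : IsCompact (closureIn U (x '' Iio i)) := by
            have : closureIn U (x '' Iio i) = x '' Iio i := by
              rw [closureIn, hf.isClosed.closure_eq, inter_eq_left.2 hfU]
            rw [this]
            exact hf.isCompact
          obtain ⟨k, hk⟩ := (key hfU).1 hc
          exact ⟨k, h2.trans hk⟩
      obtain ⟨k, hk⟩ := (key (inter_subset_left.trans (opU hV))).1 (h _ hC)
      exact hxK k (hk ⟨hxV k, k, rfl⟩)
    · rintro ⟨hV, i, hi⟩
      refine ⟨hV, fun C hC => (key (inter_subset_left.trans (opU hV))).2 ?_⟩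
      obtain ⟨k, hk⟩ := ((hpol C).1 hC).2 i
      refine ⟨max i k, ?_⟩
      rintro y ⟨hyV, hyC⟩
      rcases hi hyV with h | h
      · exact hKmono (le_max_right i k) (hk ⟨hyC, h⟩)
      · exact hKmono (le_max_left i k) h
  · ext C
    rw [hpol]
    refine and_congr_right fun hC => forall_congr' fun i => exists_congr fun k => ?_
    constructor
    · intro h y hy
      by_cases hyO : y ∈ O i
      · exact Or.inr (h ⟨hy, hyO⟩)
      · exact Or.inl ⟨clU hC hy, hyO⟩
    · rintro h y ⟨hy, hyO⟩
      rcases h hy with h | h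
      · exact absurd hyO h.2
      · exact h
end

section
/- Let 𝓒₁ and 𝓒₂ be polar families of closed subsets of U₁ and U₂ respectively. Then the bipolar (𝓒₁ × 𝓒₂)°° of the family 𝓒₁ × 𝓒₂ of products equals {F closed in U : ∃ F₁ ∈ 𝓒₁, ∃ F₂ ∈ 𝓒₂, F ⊆ F₁ × F₂}; equivalently, a closed set F ⊆ U lies in (𝓒₁ × 𝓒₂)°° if and only if the closure in U₁ of its first projection lies in 𝓒₁ and the closure in U₂ of its second projection lies in 𝓒₂. -/
open Set Metric

theorem relc_iff {X : Type*} [MetricSpace X] {U A : Set X} (hA : A ⊆ U) :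
    IsCompact (closureIn U A) ↔ ∃ K, IsCompact K ∧ K ⊆ U ∧ A ⊆ K := by
  constructor
  · intro h
    exact ⟨_, h, inter_subset_right, fun x hx => ⟨subset_closure hx, hA hx⟩⟩
  · rintro ⟨K, hK, hKU, hAK⟩
    have h1 : closure A ⊆ K := closure_minimal hAK hK.isClosed
    have h2 : closureIn U A = closure A := inter_eq_left.2 (h1.trans hKU)
    rw [h2]
    exact hK.of_isClosed_subset isClosed_closure h1

theorem exists_exh {X : Type*} [MetricSpace X] [ProperSpace X] {U : Set X} (hU : IsOpen U) :
    ∃ K : ℕ → Set X, Monotone K ∧ (∀ n, IsCompact (K n)) ∧ (∀ n, K n ⊆ U) ∧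
      ∀ L, IsCompact L → L ⊆ U → ∃ n, L ⊆ K n := by
  haveI : LocallyCompactSpace U := hU.locallyCompactSpace
  let E : CompactExhaustion U := default
  refine ⟨fun n => Subtype.val '' E n, fun m n h => image_mono (E.subset h),
    fun n => (E.isCompact n).image continuous_subtype_val, fun n => by
      rintro _ ⟨x, -, rfl⟩
      exact x.2, ?_⟩
  intro L hL hLU
  have : IsCompact (Subtype.val ⁻¹' L : Set U) := by
    rw [Subtype.isCompact_iff, Subtype.image_preimage_coe, inter_eq_right.2 hLU]
    exact hL
  obtain ⟨n, hn⟩ := E.exists_superset_of_isCompact this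
  exact ⟨n, fun x hx => ⟨⟨x, hLU hx⟩, hn hx, rfl⟩⟩

theorem closedIn_sub {X : Type*} [MetricSpace X] {U A : Set X} (h : IsClosedIn U A) : A ⊆ U := by
  obtain ⟨F, -, rfl⟩ := h
  exact inter_subset_right

theorem openIn_sub {X : Type*} [MetricSpace X] {U A : Set X} (h : IsOpenIn U A) : A ⊆ U := by
  obtain ⟨F, -, rfl⟩ := h
  exact inter_subset_right

theorem proj_mem {X Z : Type*} [MetricSpace X] [ProperSpace X] [MetricSpace Z] [ProperSpace Z]
    {U₁ : Set X} (hU₁ : IsOpen U₁) {U : Set Z} (hU : IsOpen U) (p : Z → X) (hp : Continuous p)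
    (hpU : ∀ z ∈ U, p z ∈ U₁) (𝓒₁ : Set (Set X)) (𝓒 : Set (Set Z))
    (h𝓒 : ∀ C ∈ 𝓒, ∃ F ∈ 𝓒₁, ∀ z ∈ C, p z ∈ F) {S : Set Z}
    (hS : S ∈ polarO U (polarC U 𝓒)) :
    closureIn U₁ (p '' S) ∈ polarO U₁ (polarC U₁ 𝓒₁) := by
  obtain ⟨hScl, hS⟩ := hS
  have hSU := closedIn_sub hScl
  refine ⟨⟨_, isClosed_closure, rfl⟩, ?_⟩
  rintro V ⟨hVo, hV⟩
  have hVU := openIn_sub hVo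
  have hVopen : IsOpen V := by
    obtain ⟨W, hW, rfl⟩ := hVo
    exact hW.inter hU₁
  rw [relc_iff (fun x hx => hVU hx.2)]
  suffices h : ∃ K, IsCompact K ∧ K ⊆ U₁ ∧ (p '' S) ∩ V ⊆ K by
    obtain ⟨K, hK, hKU, h⟩ := h
    refine ⟨K, hK, hKU, ?_⟩
    have h1 : closure (p '' S ∩ V) ⊆ K := closure_minimal h hK.isClosed
    exact fun x hx => h1 (hVopen.closure_inter ⟨hx.1.1, hx.2⟩)
  obtain ⟨K, hKmono, hKc, hKU, hK⟩ := exists_exh hU₁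
  by_contra hcon
  have hnot : ∀ n, ∃ z ∈ S, p z ∈ V ∧ p z ∉ K n := by
    intro n
    by_contra hc
    push Not at hc
    apply hcon
    refine ⟨K n, hKc n, hKU n, ?_⟩
    rintro _ ⟨⟨z, hz, rfl⟩, hv⟩
    exact hc z hz hv
  choose z hzS hzV hzK using hnot
  have hN : ∀ n, ∃ N : Set Z, IsOpen N ∧ z n ∈ N ∧ closure N ⊆ U ∩ (p ⁻¹' (V \ K n)) ∧
      IsCompact (closure N) := by
    intro n
    have ho : IsOpen (U ∩ (p ⁻¹' (V \ K n))) :=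
      hU.inter ((hVopen.sdiff (hKc n).isClosed).preimage hp)
    obtain ⟨N, h1, h2, h3, h4⟩ := exists_open_between_and_isCompact_closure
      (isCompact_singleton (x := z n)) ho
      (singleton_subset_iff.2 ⟨hSU (hzS n), hzV n, hzK n⟩)
    exact ⟨N, h1, h2 rfl, h3, h4⟩
  choose N hNo hzN hNsub hNc using hN
  have hWU : (⋃ n, N n) ⊆ U := iUnion_subset fun n => subset_closure.trans
    ((hNsub n).trans inter_subset_left)
  have hW : (⋃ n, N n) ∈ polarC U 𝓒 := by
    refine ⟨⟨_, isOpen_iUnion hNo, (inter_eq_left.2 hWU).symm⟩, ?_⟩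
    intro C hC
    obtain ⟨F, hF, hCF⟩ := h𝓒 C hC
    rw [relc_iff (fun x hx => hWU hx.1)]
    obtain ⟨L, hL, hLU, hVL⟩ := (relc_iff (fun x hx => hVU hx.1)).1 (hV F hF)
    obtain ⟨m, hm⟩ := hK L hL hLU
    refine ⟨⋃ n ∈ Finset.range m, closure (N n),
      (Finset.range m).isCompact_biUnion fun n _ => hNc n,
      iUnion₂_subset fun n _ => (hNsub n).trans inter_subset_left, ?_⟩
    rintro w ⟨hw, hwC⟩
    obtain ⟨n, hn⟩ := mem_iUnion.1 hw
    have h1 := hNsub n (subset_closure hn)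
    refine mem_iUnion₂.2 ⟨n, ?_, subset_closure hn⟩
    rw [Finset.mem_range]
    by_contra hmn
    exact h1.2.2 (hKmono (not_lt.1 hmn) (hm (hVL ⟨h1.2.1, hCF w hwC⟩)))
  obtain ⟨L, hL, hLU, hSL⟩ := (relc_iff (fun x hx => hSU hx.1)).1 (hS _ hW)
  obtain ⟨m, hm⟩ := hK (p '' L) (hL.image hp) (by
    rintro _ ⟨w, hw, rfl⟩
    exact hpU w (hLU hw))
  exact hzK m (hm ⟨_, hSL ⟨hzS m, mem_iUnion.2 ⟨m, hzN m⟩⟩, rfl⟩)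

/-- bipolar of a product of polar families of closed sets. -/
theorem stmt2 {X Y : Type*} [MetricSpace X] [ProperSpace X] [MetricSpace Y] [ProperSpace Y]
    (U₁ : Set X) (hU₁ : IsOpen U₁) (U₂ : Set Y) (hU₂ : IsOpen U₂)
    (𝓒₁ : Set (Set X)) (hcl₁ : ∀ C ∈ 𝓒₁, IsClosedIn U₁ C)
    (hpol₁ : 𝓒₁ = polarO U₁ (polarC U₁ 𝓒₁))
    (𝓒₂ : Set (Set Y)) (hcl₂ : ∀ C ∈ 𝓒₂, IsClosedIn U₂ C)
    (hpol₂ : 𝓒₂ = polarO U₂ (polarC U₂ 𝓒₂)) :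
    polarO (U₁ ×ˢ U₂) (polarC (U₁ ×ˢ U₂) {S | ∃ F₁ ∈ 𝓒₁, ∃ F₂ ∈ 𝓒₂, S = F₁ ×ˢ F₂}) =
      {S | IsClosedIn (U₁ ×ˢ U₂) S ∧ ∃ F₁ ∈ 𝓒₁, ∃ F₂ ∈ 𝓒₂, S ⊆ F₁ ×ˢ F₂} ∧
    ∀ S : Set (X × Y), IsClosedIn (U₁ ×ˢ U₂) S →
      (S ∈ polarO (U₁ ×ˢ U₂) (polarC (U₁ ×ˢ U₂) {T | ∃ F₁ ∈ 𝓒₁, ∃ F₂ ∈ 𝓒₂, T = F₁ ×ˢ F₂}) ↔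
        closureIn U₁ (Prod.fst '' S) ∈ 𝓒₁ ∧ closureIn U₂ (Prod.snd '' S) ∈ 𝓒₂) := by
  have hU := hU₁.prod hU₂
  set 𝓒 : Set (Set (X × Y)) := {S | ∃ F₁ ∈ 𝓒₁, ∃ F₂ ∈ 𝓒₂, S = F₁ ×ˢ F₂} with h𝓒
  have key1 : ∀ S ∈ polarO (U₁ ×ˢ U₂) (polarC (U₁ ×ˢ U₂) 𝓒),
      closureIn U₁ (Prod.fst '' S) ∈ 𝓒₁ ∧ closureIn U₂ (Prod.snd '' S) ∈ 𝓒₂ := by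
    intro S hS
    constructor
    · rw [hpol₁]
      refine proj_mem hU₁ hU Prod.fst continuous_fst (fun z hz => hz.1) 𝓒₁ 𝓒 ?_ hS
      rintro _ ⟨F₁, h₁, F₂, h₂, rfl⟩
      exact ⟨F₁, h₁, fun z hz => hz.1⟩
    · rw [hpol₂]
      refine proj_mem hU₂ hU Prod.snd continuous_snd (fun z hz => hz.2) 𝓒₂ 𝓒 ?_ hS
      rintro _ ⟨F₁, h₁, F₂, h₂, rfl⟩
      exact ⟨F₂, h₂, fun z hz => hz.2⟩
  have key2 : ∀ S, IsClosedIn (U₁ ×ˢ U₂) S → S ⊆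
      closureIn U₁ (Prod.fst '' S) ×ˢ closureIn U₂ (Prod.snd '' S) := by
    intro S hS z hz
    have hzU := closedIn_sub hS hz
    exact ⟨⟨subset_closure ⟨z, hz, rfl⟩, hzU.1⟩, ⟨subset_closure ⟨z, hz, rfl⟩, hzU.2⟩⟩
  have key3 : ∀ S, IsClosedIn (U₁ ×ˢ U₂) S → (∃ F₁ ∈ 𝓒₁, ∃ F₂ ∈ 𝓒₂, S ⊆ F₁ ×ˢ F₂) →
      S ∈ polarO (U₁ ×ˢ U₂) (polarC (U₁ ×ˢ U₂) 𝓒) := by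
    rintro S hS ⟨F₁, h₁, F₂, h₂, hSF⟩
    refine ⟨hS, ?_⟩
    rintro W ⟨hWo, hW⟩
    have hSU := closedIn_sub hS
    have hWU := openIn_sub hWo
    rw [relc_iff (fun x hx => hSU hx.1)]
    obtain ⟨L, hL, hLU, hWL⟩ := (relc_iff (fun x hx => hWU hx.1)).1
      (hW _ ⟨F₁, h₁, F₂, h₂, rfl⟩)
    exact ⟨L, hL, hLU, fun x hx => hWL ⟨hx.2, hSF hx.1⟩⟩
  constructor
  · ext S
    constructor
    · intro hS
      obtain ⟨h1, h2⟩ := key1 S hS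
      exact ⟨hS.1, _, h1, _, h2, key2 S hS.1⟩
    · rintro ⟨hS, h⟩
      exact key3 S hS h
  · intro S hS
    exact ⟨key1 S, fun h => key3 S hS ⟨_, h.1, _, h.2, key2 S hS⟩⟩
end

section
/- Let 𝓒₁ and 𝓒₂ be polar families of closed subsets of U. Then 𝓒₁ ∩ 𝓒₂ = ({V open in U : ∃ V₁ ∈ 𝓒₁°, ∃ V₂ ∈ 𝓒₂°, V ⊆ V₁ ∪ V₂})°; in particular, the family 𝓒₁ ∩ 𝓒₂ is polar. -/
open Set Metric

theorem aux_mono {X : Type*} [MetricSpace X] (U : Set X) {A B : Set X} (h : A ⊆ B)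
    (hB : IsCompact (closureIn U B)) : IsCompact (closureIn U A) := by
  have : closureIn U A = closureIn U B ∩ closure A := by
    ext x
    constructor
    · rintro ⟨h1, h2⟩
      exact ⟨⟨closure_mono h h1, h2⟩, h1⟩
    · rintro ⟨⟨_, h2⟩, h1⟩
      exact ⟨h1, h2⟩
  rw [this]
  exact hB.inter_right isClosed_closure

theorem aux_empty {X : Type*} [MetricSpace X] (U : Set X) (𝓒 : Set (Set X)) :
    (∅ : Set X) ∈ polarC U 𝓒 :=
  ⟨⟨∅, isOpen_empty, by simp⟩, fun C _ => by simp [closureIn]⟩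

/-- the intersection of two polar families of closed sets is polar. -/
theorem stmt3 {X : Type*} [MetricSpace X] [ProperSpace X]
    (U : Set X) (hU : IsOpen U)
    (𝓒₁ 𝓒₂ : Set (Set X))
    (hcl₁ : ∀ C ∈ 𝓒₁, IsClosedIn U C) (hcl₂ : ∀ C ∈ 𝓒₂, IsClosedIn U C)
    (hpol₁ : 𝓒₁ = polarO U (polarC U 𝓒₁)) (hpol₂ : 𝓒₂ = polarO U (polarC U 𝓒₂)) :
    𝓒₁ ∩ 𝓒₂ =
      polarO U {V | IsOpenIn U V ∧ ∃ V₁ ∈ polarC U 𝓒₁, ∃ V₂ ∈ polarC U 𝓒₂, V ⊆ V₁ ∪ V₂} ∧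
    𝓒₁ ∩ 𝓒₂ = polarO U (polarC U (𝓒₁ ∩ 𝓒₂)) := by
  have key : 𝓒₁ ∩ 𝓒₂ = polarO U
      {V | IsOpenIn U V ∧ ∃ V₁ ∈ polarC U 𝓒₁, ∃ V₂ ∈ polarC U 𝓒₂, V ⊆ V₁ ∪ V₂} := by
    ext C
    constructor
    · rintro ⟨h1, h2⟩
      refine ⟨hcl₁ C h1, ?_⟩
      rintro V ⟨_, V₁, hV₁, V₂, hV₂, hV⟩
      refine aux_mono U (A := C ∩ V) (B := (V₁ ∩ C) ∪ (V₂ ∩ C)) ?_ ?_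
      · rintro x ⟨hx, hxV⟩
        rcases hV hxV with h | h
        · exact Or.inl ⟨h, hx⟩
        · exact Or.inr ⟨h, hx⟩
      · have := (hV₁.2 C h1).union (hV₂.2 C h2)
        simpa only [closureIn, closure_union, union_inter_distrib_right] using this
    · rintro ⟨hC, h⟩
      constructor
      · rw [hpol₁]
        exact ⟨hC, fun W hW => h W ⟨hW.1, W, hW, ∅, aux_empty U _, subset_union_left⟩⟩
      · rw [hpol₂]
        exact ⟨hC, fun W hW => h W ⟨hW.1, ∅, aux_empty U _, W, hW, subset_union_right⟩⟩
  refine ⟨key, ?_⟩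
  apply Subset.antisymm
  · intro C hC
    exact ⟨hcl₁ C hC.1, fun W hW => by rw [inter_comm]; exact hW.2 C hC⟩
  · rintro C ⟨hC, h⟩
    rw [key]
    refine ⟨hC, fun V hV => h V ⟨hV.1, fun D hD => ?_⟩⟩
    rw [key] at hD
    rw [inter_comm]
    exact hD.2 V hV
end

section
/- Let 𝓞₁ = {P_n : n ∈ ℕ}°° and 𝓞₂ = {Q_n : n ∈ ℕ}°° be countably generated polar families of open subsets of U (each P_n, Q_n open in U). Then the family 𝓦 = {V open in U : ∃ V₁ ∈ 𝓞₁, ∃ V₂ ∈ 𝓞₂, V ⊆ V₁ ∪ V₂} is itself polar, i.e. 𝓦 = 𝓦°°; indeed 𝓦 = {P_n ∪ Q_m : n, m ∈ ℕ}°°, so 𝓦 is countably generated. -/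
open Set Metric

theorem aux_cpt_s4 {X : Type*} [MetricSpace X] {U S L : Set X} (h : S ⊆ L) (hL : IsCompact L)
    (hLU : L ⊆ U) : IsCompact (closureIn U S) := by
  have h1 : closure S ⊆ L := closure_minimal h hL.isClosed
  have h2 : closureIn U S = closure S := inter_eq_left.2 (h1.trans hLU)
  rw [h2]
  exact hL.of_isClosed_subset isClosed_closure h1

theorem aux_bip {X : Type*} [MetricSpace X] [ProperSpace X]
    (U : Set X) (hU : IsOpen U) (A : ℕ → Set X) (hA : ∀ n, IsOpenIn U (A n)) (V : Set X) :
    V ∈ polarC U (polarO U (Set.range A)) ↔ IsOpenIn U V ∧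
      ∃ n : ℕ, ∃ K, IsCompact K ∧ K ⊆ U ∧ V ⊆ (⋃ i ∈ Set.Iic n, A i) ∪ K := by
  constructor
  · rintro ⟨hV, h⟩
    refine ⟨hV, ?_⟩
    by_contra hcon
    push Not at hcon
    haveI : LocallyCompactSpace U := hU.locallyCompactSpace
    let E : CompactExhaustion U := default
    have hK : ∀ n, IsCompact (Subtype.val '' (E n) : Set X) := fun n =>
      (E.isCompact n).image continuous_subtype_val
    have hKU : ∀ n, (Subtype.val '' (E n) : Set X) ⊆ U := by
      rintro n _ ⟨y, _, rfl⟩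
      exact y.2
    have hx : ∀ n, ∃ x ∈ V, x ∉ (⋃ i ∈ Set.Iic n, A i) ∪ Subtype.val '' (E n) := fun n =>
      Set.not_subset.1 (hcon n _ (hK n) (hKU n))
    choose x hxV hx using hx
    have hVU : V ⊆ U := by
      obtain ⟨W, _, rfl⟩ := hV
      exact inter_subset_right
    have hC : closure (Set.range x) ∩ U ∈ polarO U (Set.range A) := by
      refine ⟨⟨_, isClosed_closure, rfl⟩, ?_⟩
      rintro _ ⟨n, rfl⟩
      have hfin : (x '' Set.Iio n).Finite := (Set.finite_Iio n).image x
      refine aux_cpt_s4 (L := x '' Set.Iio n) ?_ hfin.isCompact ?_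
      · rintro y ⟨⟨hy, hyU⟩, hyA⟩
        have hAo : IsOpen (A n) := by
          obtain ⟨W, hW, h⟩ := hA n
          rw [h]
          exact hW.inter hU
        have h1 := hAo.inter_closure ⟨hyA, hy⟩
        refine closure_minimal ?_ hfin.isClosed h1
        rintro _ ⟨hz, k, rfl⟩
        refine ⟨k, ?_, rfl⟩
        by_contra hk
        apply hx k
        left
        exact mem_biUnion (x := n) (by simpa using hk) hz
      · rintro _ ⟨k, _, rfl⟩
        exact hVU (hxV k)
    have hc := h _ hC
    have hc' : IsCompact (Subtype.val ⁻¹' (closureIn U (V ∩ (closure (Set.range x) ∩ U))) : Set U) := by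
      rw [Topology.IsInducing.subtypeVal.isCompact_iff, Subtype.image_preimage_coe]
      rwa [inter_eq_right.2]
      exact inter_subset_right
    obtain ⟨m, hm⟩ := E.exists_superset_of_isCompact hc'
    apply hx m
    right
    refine ⟨⟨x m, hVU (hxV m)⟩, hm ?_, rfl⟩
    exact ⟨subset_closure ⟨hxV m, subset_closure ⟨m, rfl⟩, hVU (hxV m)⟩, hVU (hxV m)⟩
  · rintro ⟨hV, n, K, hK, hKU, hVK⟩
    refine ⟨hV, ?_⟩
    rintro C ⟨⟨F, hF, rfl⟩, hC⟩
    refine aux_cpt_s4 (L := (⋃ i ∈ Set.Iic n, closureIn U ((F ∩ U) ∩ A i)) ∪ K) ?_ ?_ ?_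
    · rintro y ⟨hy, hyC⟩
      rcases hVK hy with h | h
      · left
        obtain ⟨i, hi, hy'⟩ := mem_iUnion₂.1 h
        exact mem_biUnion hi ⟨subset_closure ⟨hyC, hy'⟩, hyC.2⟩
      · exact Or.inr h
    · exact ((Set.finite_Iic n).isCompact_biUnion fun i _ => hC _ ⟨i, rfl⟩).union hK
    · refine union_subset (iUnion₂_subset fun i _ => inter_subset_right) hKU

theorem aux_tri {X : Type*} [MetricSpace X] (U : Set X) (O : Set (Set X)) :
    polarC U (polarO U (polarC U (polarO U O))) = polarC U (polarO U O) := by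
  apply Subset.antisymm
  · rintro V ⟨hV, h⟩
    refine ⟨hV, fun C hC => h C ⟨hC.1, fun W hW => ?_⟩⟩
    rw [inter_comm]
    exact hW.2 C hC
  · rintro V hV
    refine ⟨hV.1, fun C hC => ?_⟩
    rw [inter_comm]
    exact hC.2 V hV

theorem aux_open {X : Type*} [MetricSpace X] {U : Set X} (hU : IsOpen U) {V : Set X} :
    IsOpenIn U V ↔ IsOpen V ∧ V ⊆ U := by
  constructor
  · rintro ⟨W, hW, rfl⟩
    exact ⟨hW.inter hU, inter_subset_right⟩
  · rintro ⟨h, h'⟩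
    exact ⟨V, h, (inter_eq_left.2 h').symm⟩

theorem aux_main {X : Type*} [MetricSpace X] [ProperSpace X]
    (U : Set X) (hU : IsOpen U)
    (P Q : ℕ → Set X) (hP : ∀ n, IsOpenIn U (P n)) (hQ : ∀ n, IsOpenIn U (Q n)) :
    {V | IsOpenIn U V ∧ ∃ V₁ ∈ polarC U (polarO U (Set.range P)),
        ∃ V₂ ∈ polarC U (polarO U (Set.range Q)), V ⊆ V₁ ∪ V₂} =
      polarC U (polarO U {S | ∃ n m, S = P n ∪ Q m}) := by
  have hS : {S | ∃ n m, S = P n ∪ Q m} =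
      Set.range (fun k : ℕ => P k.unpair.1 ∪ Q k.unpair.2) := by
    ext S
    constructor
    · rintro ⟨n, m, rfl⟩
      exact ⟨Nat.pair n m, by simp⟩
    · rintro ⟨k, rfl⟩
      exact ⟨_, _, rfl⟩
  have hSo : ∀ k : ℕ, IsOpenIn U (P k.unpair.1 ∪ Q k.unpair.2) := fun k => by
    have h1 := (aux_open hU).1 (hP k.unpair.1)
    have h2 := (aux_open hU).1 (hQ k.unpair.2)
    exact (aux_open hU).2 ⟨h1.1.union h2.1, union_subset h1.2 h2.2⟩
  have hun : ∀ (A : ℕ → Set X), (∀ n, IsOpenIn U (A n)) → ∀ (n : ℕ) (K : Set X), IsCompact K →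
      K ⊆ U → ∃ V ∈ polarC U (polarO U (Set.range A)), (⋃ i ∈ Set.Iic n, A i) ∪ K ⊆ V := by
    intro A hA n K hK hKU
    obtain ⟨L, hL, hKL, hLU⟩ := exists_compact_between hK hU hKU
    refine ⟨(⋃ i ∈ Set.Iic n, A i) ∪ interior L, ?_, union_subset_union_right _ hKL⟩
    rw [aux_bip U hU A hA]
    refine ⟨(aux_open hU).2 ⟨?_, ?_⟩, n, L, hL, hLU, union_subset_union_right _ interior_subset⟩
    · exact (isOpen_biUnion fun i _ => ((aux_open hU).1 (hA i)).1).union isOpen_interior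
    · exact union_subset (iUnion₂_subset fun i _ => ((aux_open hU).1 (hA i)).2)
        (interior_subset.trans hLU)
  rw [hS]
  ext V
  rw [aux_bip U hU _ hSo]
  constructor
  · rintro ⟨hV, V₁, h1, V₂, h2, hsub⟩
    obtain ⟨_, n, K, hK, hKU, hn⟩ := (aux_bip U hU P hP V₁).1 h1
    obtain ⟨_, m, L, hL, hLU, hm⟩ := (aux_bip U hU Q hQ V₂).1 h2
    -- every index pair (i, 0) and (0, j) is at most N
    refine ⟨hV, max (Nat.pair n 0) (Nat.pair 0 m), K ∪ L, hK.union hL, union_subset hKU hLU, ?_⟩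
    intro y hy
    rcases hsub hy with h | h
    · rcases hn h with h | h
      · obtain ⟨i, hi, hy'⟩ := mem_iUnion₂.1 h
        left
        refine mem_biUnion (x := Nat.pair i 0) ?_ (by left; simpa using hy')
        have : Nat.pair i 0 ≤ Nat.pair n 0 :=
          (StrictMono.monotone fun a b h => Nat.pair_lt_pair_left 0 h) hi
        exact le_max_of_le_left this
      · exact Or.inr (Or.inl h)
    · rcases hm h with h | h
      · obtain ⟨i, hi, hy'⟩ := mem_iUnion₂.1 h
        left
        refine mem_biUnion (x := Nat.pair 0 i) ?_ (by right; simpa using hy')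
        have : Nat.pair 0 i ≤ Nat.pair 0 m :=
          (StrictMono.monotone fun a b h => Nat.pair_lt_pair_right 0 h) hi
        exact le_max_of_le_right this
      · exact Or.inr (Or.inr h)
  · rintro ⟨hV, n, K, hK, hKU, hn⟩
    obtain ⟨V₁, h1, h1'⟩ := hun P hP n K hK hKU
    obtain ⟨V₂, h2, h2'⟩ := hun Q hQ n K hK hKU
    refine ⟨hV, V₁, h1, V₂, h2, ?_⟩
    intro y hy
    rcases hn hy with h | h
    · obtain ⟨i, hi, hy'⟩ := mem_iUnion₂.1 h
      rcases hy' with h | h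
      · exact Or.inl (h1' (Or.inl (mem_biUnion (x := i.unpair.1)
          (le_trans (Nat.unpair_left_le i) hi) h)))
      · exact Or.inr (h2' (Or.inl (mem_biUnion (x := i.unpair.2)
          (le_trans (Nat.unpair_right_le i) hi) h)))
    · exact Or.inl (h1' (Or.inr h))

/-- the "union" family of two countably generated polar families of open sets is
polar and countably generated. -/
theorem stmt4 {X : Type*} [MetricSpace X] [ProperSpace X]
    (U : Set X) (hU : IsOpen U)
    (P Q : ℕ → Set X) (hP : ∀ n, IsOpenIn U (P n)) (hQ : ∀ n, IsOpenIn U (Q n)) :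
    {V | IsOpenIn U V ∧ ∃ V₁ ∈ polarC U (polarO U (Set.range P)),
        ∃ V₂ ∈ polarC U (polarO U (Set.range Q)), V ⊆ V₁ ∪ V₂} =
      polarC U (polarO U {V | IsOpenIn U V ∧ ∃ V₁ ∈ polarC U (polarO U (Set.range P)),
        ∃ V₂ ∈ polarC U (polarO U (Set.range Q)), V ⊆ V₁ ∪ V₂}) ∧
    {V | IsOpenIn U V ∧ ∃ V₁ ∈ polarC U (polarO U (Set.range P)),
        ∃ V₂ ∈ polarC U (polarO U (Set.range Q)), V ⊆ V₁ ∪ V₂} =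
      polarC U (polarO U {S | ∃ n m, S = P n ∪ Q m}) := by
  have h := aux_main U hU P Q hP hQ
  refine ⟨?_, h⟩
  rw [h, aux_tri]
end

section
/- For all closed subsets C and V of U and every ε ∈ (0, ln 3)^I, one has cl_U(C ∩ V_ε) ⊆ (C_{δ∘ε} ∩ V)_{wε}, where (δ∘ε)_i = δ(ε_i) for each i ∈ I. -/
open Set Metric

theorem aux_delta (t : ℝ) (h0 : 0 < t) (h3 : t < Real.log 3) :
    t ≤ deltaFn t ∧ (1 - Real.exp (-deltaFn t)) / 2 =
      (1 - Real.exp (-t)) / (1 + Real.exp (-t)) ∧ Real.exp (-t) < 1 := by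
  have he0 := Real.exp_pos (-t)
  have he1 : Real.exp (-t) < 1 := by rw [Real.exp_lt_one_iff]; linarith
  have he3 : 1 < 3 * Real.exp (-t) := by
    have : Real.exp (-Real.log 3) < Real.exp (-t) := Real.exp_lt_exp.2 (by linarith)
    rw [Real.exp_neg, Real.exp_log (by norm_num)] at this
    linarith
  have hp : 0 < (1 + Real.exp (-t)) / (3 * Real.exp (-t) - 1) :=
    div_pos (by linarith) (by linarith)
  refine ⟨?_, ?_, he1⟩
  · unfold deltaFn
    rw [Real.le_log_iff_exp_le hp, le_div_iff₀ (by linarith)]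
    have h1 : Real.exp t * Real.exp (-t) = 1 := by rw [← Real.exp_add]; simp
    have h2 := Real.add_one_le_exp t
    have hpos := Real.exp_pos t
    have : 0 ≤ Real.exp t * (1 - Real.exp (-t)) ^ 2 := by positivity
    have h4 : Real.exp t * (1 - Real.exp (-t)) ^ 2 =
      Real.exp t - 2 * (Real.exp t * Real.exp (-t))
        + (Real.exp t * Real.exp (-t)) * Real.exp (-t) := by ring
    rw [h1] at h4
    have h5 : Real.exp t * (3 * Real.exp (-t) - 1) =
      3 * (Real.exp t * Real.exp (-t)) - Real.exp t := by ring
    rw [h5, h1]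
    linarith
  · unfold deltaFn
    rw [Real.exp_neg (Real.log _), Real.exp_log hp]
    have : 3 * Real.exp (-t) - 1 ≠ 0 := by linarith
    have : 1 + Real.exp (-t) ≠ 0 := by linarith
    rw [inv_div]
    field_simp
    ring

theorem aux_enn (r e : ℝ) (hr : 0 ≤ r) (h0 : 0 < e) (h1 : e < 1) (a b : ENNReal)
    (hab : a ≤ b + ENNReal.ofReal r)
    (h : ENNReal.ofReal r ≤ a * ENNReal.ofReal ((1 - e) / 2)) :
    ENNReal.ofReal r ≤ b * ENNReal.ofReal ((1 - e) / (1 + e)) := by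
  have hk : 0 < (1 - e) / (1 + e) := div_pos (by linarith) (by linarith)
  rcases eq_or_ne b ⊤ with rfl | hb
  · rw [ENNReal.top_mul]
    · exact le_top
    · simpa using hk
  · lift b to NNReal using hb
    have h2 : ENNReal.ofReal r ≤
        ENNReal.ofReal ((b + r) * ((1 - e) / 2)) := by
      rw [ENNReal.ofReal_mul (by positivity), ENNReal.ofReal_add b.coe_nonneg hr]
      rw [ENNReal.ofReal_coe_nnreal]
      exact h.trans (by gcongr)
    have hb0 : (0 : ℝ) ≤ b := b.2
    rw [ENNReal.ofReal_le_ofReal_iff (mul_nonneg (by linarith) (by linarith))] at h2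
    rw [← ENNReal.ofReal_coe_nnreal, ← ENNReal.ofReal_mul hb0]
    apply ENNReal.ofReal_le_ofReal
    rw [mul_div_assoc', le_div_iff₀ (by linarith)]
    linarith

theorem aux_closed {X : Type*} [MetricSpace X] (U A K : Set X) (hA : IsCompact A)
    (hAU : A ⊆ U) (hK : IsCompact K) (ε : ℝ) : IsClosed (A ∩ uEnl U K ε) := by
  have hcl : IsClosed {p : X × X | dist p.1 p.2 ≤ ε ∧ ENNReal.ofReal (dist p.1 p.2) ≤
      EMetric.infEdist p.2 Uᶜ * ENNReal.ofReal ((1 - Real.exp (-ε)) / 2)} := by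
    apply IsClosed.inter
    · exact isClosed_le (f := fun p : X × X => dist p.1 p.2) (g := fun _ => ε)
        (by fun_prop) (by fun_prop)
    · refine isClosed_le (f := fun p : X × X => ENNReal.ofReal (dist p.1 p.2))
        (ENNReal.continuous_ofReal.comp (by fun_prop)) ?_
      exact (ENNReal.continuous_mul_const ENNReal.ofReal_ne_top).comp
        (continuous_infEDist.comp continuous_snd)
  have := (((hA.prod hK).inter_right hcl).image continuous_fst).isClosed
  convert this using 1
  ext x
  constructor
  · rintro ⟨hx, -, y, hy, h⟩
    exact ⟨(x, y), ⟨⟨hx, hy⟩, h⟩, rfl⟩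
  · rintro ⟨⟨x, y⟩, ⟨⟨hx, hy⟩, h⟩, rfl⟩
    exact ⟨hx, hAU hx, y, hy, h⟩

/-- `cl_U(C ∩ V_ε) ⊆ (C_{δ∘ε} ∩ V)_{wε}` for closed `C, V ⊆ U` and
`ε ∈ (0, ln 3)^I`. -/
theorem stmt5 {X : Type*} [MetricSpace X] [ProperSpace X] {I : Type*}
    (U : Set X) (hU : IsOpen U) (Ui : I → Set X) (hcov : GoodCover Ui U)
    (C V : Set X) (hC : IsClosedIn U C) (hV : IsClosedIn U V)
    (ε : I → ℝ) (hε : ∀ i, 0 < ε i ∧ ε i < Real.log 3) :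
    closureIn U (C ∩ coverEnl Ui U V ε) ⊆
      coverWEnl Ui U ((coverEnl Ui U C fun i => deltaFn (ε i)) ∩ V) ε := by
  rintro x ⟨hx, hxU⟩
  obtain ⟨F, hF, rfl⟩ := hV
  obtain ⟨G, hG, rfl⟩ := hC
  have hxG : x ∈ G := by
    have : closure ((G ∩ U) ∩ coverEnl Ui U (F ∩ U) ε) ⊆ G :=
      closure_minimal (fun z hz => hz.1.1) hG
    exact this hx
  have hcl : ∀ i, IsClosed (closure (Ui i) ∩ uEnl U (closure (Ui i) ∩ (F ∩ U)) (ε i)) := by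
    intro i
    refine aux_closed U _ _ (hcov.compactCl i) (hcov.clSubset i) ?_ _
    have : closure (Ui i) ∩ (F ∩ U) = closure (Ui i) ∩ F := by
      ext z
      have : z ∈ closure (Ui i) → z ∈ U := fun h => hcov.clSubset i h
      simp only [mem_inter_iff]
      tauto
    rw [this]
    exact (hcov.compactCl i).inter_right hF
  obtain ⟨t, ht, hfin⟩ := hcov.locFin x hxU
  have hxV : x ∈ ⋃ i ∈ {i | (closure (Ui i) ∩ t).Nonempty},
      closure (Ui i) ∩ uEnl U (closure (Ui i) ∩ (F ∩ U)) (ε i) := by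
    rw [← (hfin.isClosed_biUnion fun i _ => hcl i).closure_eq, mem_closure_iff_nhds]
    intro s hs
    obtain ⟨z, ⟨hzs, hzt⟩, hz⟩ := mem_closure_iff_nhds.1 hx (s ∩ t) (Filter.inter_mem hs ht)
    obtain ⟨i, hi⟩ := mem_iUnion.1 hz.2
    exact ⟨z, hzs, mem_biUnion (show i ∈ {i | (closure (Ui i) ∩ t).Nonempty} from
      ⟨z, hi.1, hzt⟩) hi⟩
  obtain ⟨i, -, hxi, -, y, ⟨hyi, hyV⟩, hd, hd2⟩ := mem_iUnion₂.1 hxV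
  obtain ⟨h1, h2, h3⟩ := aux_delta (ε i) (hε i).1 (hε i).2
  refine mem_iUnion.2 ⟨i, hxU, y, ⟨hyi, mem_iUnion.2 ⟨i, hyi, hyV.2, x,
    ⟨hxi, hxG, hxU⟩, ?_, ?_⟩, hyV⟩, hd, hd2⟩
  · rw [dist_comm]; exact hd.trans h1
  · rw [dist_comm]
    simp only [h2]
    refine aux_enn _ _ dist_nonneg (Real.exp_pos _) h3 _ _ ?_ hd2
    rw [← edist_dist, edist_comm]
    exact infEDist_le_infEDist_add_edist
end

section
/- If 𝓒 is an openly generated polar family of closed subsets of U, then 𝓒° = {W open in U : for every V ∈ 𝓞_𝓒, the closure of W ∩ V in U is compact} = {W open in U : cl_U(W) ∈ (𝓞_𝓒)°}. -/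
open Set Metric

theorem aux_cl1 {X : Type*} [MetricSpace X] {U W V : Set X} (hW : IsOpen W) (hWU : W ⊆ U) :
    closureIn U (W ∩ closureIn U V) = closureIn U (W ∩ V) := by
  have h : W ∩ closureIn U V = W ∩ closure V := by
    ext x
    simp only [closureIn, mem_inter_iff]
    exact ⟨fun h => ⟨h.1, h.2.1⟩, fun h => ⟨h.1, h.2, hWU h.1⟩⟩
  rw [h]
  unfold closureIn
  congr 1
  apply Subset.antisymm
  · exact closure_minimal hW.inter_closure isClosed_closure
  · exact closure_mono (inter_subset_inter_right _ subset_closure)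

/-- the polar of an openly generated polar family of closed sets is computed from
the interiors of its members. -/
theorem stmt6 {X : Type*} [MetricSpace X] [ProperSpace X]
    (U : Set X) (hU : IsOpen U)
    (𝓒 : Set (Set X)) (hcl : ∀ C ∈ 𝓒, IsClosedIn U C)
    (hpolar : 𝓒 = polarO U (polarC U 𝓒))
    (hog : 𝓒 = polarO U (polarC U (cFam U (oFam U 𝓒)))) :
    polarC U 𝓒 =
      {W | IsOpenIn U W ∧ ∀ V ∈ oFam U 𝓒, IsCompact (closureIn U (W ∩ V))} ∧
    polarC U 𝓒 = {W | IsOpenIn U W ∧ closureIn U W ∈ polarO U (oFam U 𝓒)} := by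
  have key : polarC U 𝓒 = polarC U (cFam U (oFam U 𝓒)) := by
    ext W
    constructor
    · rintro ⟨hW, h⟩
      refine ⟨hW, fun C hC => h C ?_⟩
      rw [hog]
      refine ⟨?_, fun V hV => ?_⟩
      · obtain ⟨V, -, rfl⟩ := hC
        exact ⟨closure V, isClosed_closure, rfl⟩
      · rw [inter_comm]
        exact hV.2 C hC
    · intro hW
      refine ⟨hW.1, fun C hC => ?_⟩
      rw [hog] at hC
      rw [inter_comm]
      exact hC.2 W hW
  have hop : ∀ {W : Set X}, IsOpenIn U W → IsOpen W ∧ W ⊆ U := by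
    rintro W ⟨O, hO, rfl⟩
    exact ⟨hO.inter hU, inter_subset_right⟩
  have hV : ∀ V ∈ oFam U 𝓒, IsOpen V ∧ V ⊆ U := by
    rintro V ⟨C, -, rfl⟩
    exact ⟨hU.sdiff isClosed_closure, diff_subset⟩
  rw [key]
  constructor
  · ext W
    refine and_congr_right fun hW => ?_
    simp only [cFam, forall_mem_image]
    refine forall₂_congr fun V _ => ?_
    rw [aux_cl1 (hop hW).1 (hop hW).2]
  · ext W
    refine and_congr_right fun hW => ?_
    have hc : IsClosedIn U (closureIn U W) := ⟨closure W, isClosed_closure, rfl⟩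
    simp only [cFam, forall_mem_image, polarO, mem_setOf_eq, hc, true_and]
    refine forall₂_congr fun V h => ?_
    rw [aux_cl1 (hop hW).1 (hop hW).2, inter_comm (closureIn U W),
      aux_cl1 (hV V h).1 (hV V h).2, inter_comm]
end

section
/- For every closed subset C of U and every ε > 0, the uniform enlargement C_{uε} is closed in U; moreover, if C is compact then C_{uε} is compact. -/
open Set Metric

theorem s8_closed {X : Type*} [MetricSpace X] [ProperSpace X]
    (U F : Set X) (hF : IsClosed F) (ε : ℝ) (c : ENNReal) (hc : c ≠ ⊤) :
    IsClosed {x : X | ∃ y ∈ F, dist x y ≤ ε ∧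
      ENNReal.ofReal (dist x y) ≤ EMetric.infEdist y Uᶜ * c} := by
  apply IsSeqClosed.isClosed
  intro x a hx hlim
  choose y hyF hy1 hy2 using hx
  obtain ⟨R, hR⟩ := hlim.cauchySeq.isBounded_range.subset_closedBall a
  have hyb : ∀ n, y n ∈ closedBall a (R + ε) := by
    intro n
    have h1 : dist (x n) a ≤ R := hR ⟨n, rfl⟩
    have h2 := dist_triangle_left (y n) a (x n)
    rw [mem_closedBall]
    linarith [hy1 n]
  obtain ⟨b, -, φ, hφ, hb⟩ := (isCompact_closedBall a (R + ε)).tendsto_subseq hyb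
  have hxa := hlim.comp hφ.tendsto_atTop
  have hd := hxa.dist hb
  refine ⟨b, hF.mem_of_tendsto hb (Filter.Eventually.of_forall fun n => hyF _),
    le_of_tendsto hd (Filter.Eventually.of_forall fun n => hy1 _), ?_⟩
  have hcont : Continuous fun z : X => EMetric.infEdist z Uᶜ * c :=
    (ENNReal.continuous_mul_const hc).comp EMetric.continuous_infEdist
  exact le_of_tendsto_of_tendsto (ENNReal.tendsto_ofReal hd) ((hcont.tendsto b).comp hb)
    (Filter.Eventually.of_forall fun n => hy2 _)

/-- uniform enlargements of closed sets are closed in `U`, and of compact sets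
are compact. -/
theorem stmt8 {X : Type*} [MetricSpace X] [ProperSpace X]
    (U : Set X) (hU : IsOpen U)
    (C : Set X) (hC : IsClosedIn U C) (ε : ℝ) (hε : 0 < ε) :
    IsClosedIn U (uEnl U C ε) ∧ (IsCompact C → IsCompact (uEnl U C ε)) := by
  set c : ENNReal := ENNReal.ofReal ((1 - Real.exp (-ε)) / 2) with hcdef
  have hc : c ≠ ⊤ := ENNReal.ofReal_ne_top
  have hc1 : c < 1 := by
    rw [hcdef, ENNReal.ofReal_lt_one]
    linarith [Real.exp_pos (-ε)]
  obtain ⟨F, hF, rfl⟩ := hC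
  constructor
  · refine ⟨_, s8_closed U F hF ε c hc, ?_⟩
    ext x
    constructor
    · rintro ⟨hxU, y, hy, h1, h2⟩
      exact ⟨⟨y, hy.1, h1, h2⟩, hxU⟩
    · rintro ⟨⟨y, hy, h1, h2⟩, hxU⟩
      refine ⟨hxU, y, ⟨hy, ?_⟩, h1, h2⟩
      by_contra hyU
      have h0 : EMetric.infEdist y Uᶜ = 0 := EMetric.infEdist_zero_of_mem hyU
      rw [h0, zero_mul, nonpos_iff_eq_zero, ENNReal.ofReal_eq_zero] at h2
      have : x = y := dist_le_zero.1 h2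
      exact hyU (this ▸ hxU)
  · intro hK
    have hcl := s8_closed U (F ∩ U) hK.isClosed ε c hc
    have heq : uEnl U (F ∩ U) ε = {x : X | ∃ y ∈ F ∩ U, dist x y ≤ ε ∧
      ENNReal.ofReal (dist x y) ≤ EMetric.infEdist y Uᶜ * c} := by
      ext x
      constructor
      · rintro ⟨hxU, h⟩
        exact h
      · rintro ⟨y, hy, h1, h2⟩
        refine ⟨?_, y, hy, h1, h2⟩
        by_contra hxU
        have h3 : EMetric.infEdist y Uᶜ ≤ edist y x := EMetric.infEdist_le_edist_of_mem hxU
        rw [← edist_dist, edist_comm] at h2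
        have hpos : EMetric.infEdist y Uᶜ ≠ 0 := by
          intro h0
          have := (EMetric.mem_iff_infEdist_zero_of_closed hU.isClosed_compl).2 h0
          exact this hy.2
        have hfin : EMetric.infEdist y Uᶜ ≠ ⊤ := ne_top_of_le_ne_top (edist_ne_top y x) h3
        have h4 : EMetric.infEdist y Uᶜ * c < EMetric.infEdist y Uᶜ * 1 :=
          (ENNReal.mul_lt_mul_iff_right hpos hfin).2 hc1
        rw [mul_one] at h4
        exact absurd (h3.trans h2) (not_le.2 h4)
    rw [heq]
    refine Metric.isCompact_of_isClosed_isBounded hcl ?_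
    refine (hK.isBounded.cthickening (δ := ε)).subset ?_
    rintro x ⟨y, hy, h1, -⟩
    exact mem_cthickening_of_dist_le x y ε _ hy h1
end

section
/- For all subsets C and V of U and every ε with 0 < ε < ln 3, one has C ∩ V_{uε} ⊆ (V ∩ C_{uδ(ε)})_{uε}. Consequently, if C and V are closed in U, then cl_U(C ∩ V_{uε}) ⊆ (cl_U(C_{uδ(ε)} ∩ V))_{uε}. -/
open Set Metric

open Filter Topology in
theorem closure_uEnl_aux {X : Type*} [MetricSpace X] [ProperSpace X]
    (U A : Set X) (ε : ℝ) :
    closureIn U (uEnl U A ε) ⊆ uEnl U (closureIn U A) ε := by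
  rintro x ⟨hx, hxU⟩
  obtain ⟨u, hu, hux⟩ := mem_closure_iff_seq_limit.1 hx
  choose huU y hyA hy1 hy2 using hu
  obtain ⟨R, hR⟩ := (Metric.isBounded_range_of_tendsto u hux).subset_closedBall x
  have hyb : ∀ n, y n ∈ Metric.closedBall x (ε + R) := by
    intro n
    have h1 : dist (u n) x ≤ R := hR (Set.mem_range_self n)
    have h2 := dist_triangle (y n) (u n) x
    rw [dist_comm (y n) (u n)] at h2
    simp only [Metric.mem_closedBall]
    linarith [hy1 n]
  obtain ⟨z, -, φ, hφ, hz⟩ := (isCompact_closedBall x (ε + R)).tendsto_subseq hyb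
  have hux' := hux.comp hφ.tendsto_atTop
  have hd := hux'.dist hz
  have hd1 : dist x z ≤ ε := le_of_tendsto' hd fun n => hy1 (φ n)
  have hd2 : ENNReal.ofReal (dist x z) ≤
      EMetric.infEdist z Uᶜ * ENNReal.ofReal ((1 - Real.exp (-ε)) / 2) := by
    refine le_of_tendsto_of_tendsto' (ENNReal.tendsto_ofReal hd) ?_ fun n => hy2 (φ n)
    exact ENNReal.Tendsto.mul_const
      ((Metric.continuous_infEDist.tendsto z).comp hz) (Or.inr ENNReal.ofReal_ne_top)
  refine ⟨hxU, z, ⟨mem_closure_of_tendsto hz (Eventually.of_forall fun n => hyA (φ n)), ?_⟩, hd1, hd2⟩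
  by_contra hzU
  have h0 : Metric.infEDist z Uᶜ = 0 := Metric.infEDist_zero_of_mem hzU
  have h0' : EMetric.infEdist z Uᶜ = 0 := h0
  rw [h0', zero_mul] at hd2
  have : dist x z ≤ 0 := ENNReal.ofReal_eq_zero.1 (le_antisymm hd2 bot_le)
  have hxz : x = z := dist_le_zero.1 this
  exact hzU (hxz ▸ hxU)

theorem delta_facts {ε : ℝ} (hε0 : 0 < ε) (hε3 : ε < Real.log 3) :
    ε ≤ deltaFn ε ∧ 0 < Real.exp (-ε) ∧ Real.exp (-ε) < 1 ∧
    (1 - Real.exp (-deltaFn ε)) / 2 = (1 - Real.exp (-ε)) / (1 + Real.exp (-ε)) := by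
  have ha : Real.exp (-ε) < 1 := by rw [Real.exp_lt_one_iff]; linarith
  have h3 : 1 / 3 < Real.exp (-ε) := by
    rw [← Real.log_lt_iff_lt_exp (by norm_num), one_div, Real.log_inv]; linarith
  have hE : Real.exp ε = (Real.exp (-ε))⁻¹ := by rw [Real.exp_neg, inv_inv]
  unfold deltaFn
  rw [Real.le_log_iff_exp_le (div_pos (by linarith) (by linarith)), Real.exp_neg (Real.log _),
    Real.exp_log (div_pos (by linarith) (by linarith)), hE]
  generalize Real.exp (-ε) = a at *
  have h4 : 0 < 3 * a - 1 := by linarith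
  have h5 : 0 < a := by linarith
  refine ⟨?_, h5, ha, ?_⟩
  · rw [inv_eq_one_div, div_le_div_iff₀ h5 h4]
    nlinarith [sq_nonneg (a - 1)]
  · rw [inv_div]
    have : 1 + a ≠ 0 := by linarith
    field_simp
    ring

/-- `C ∩ V_{uε} ⊆ (V ∩ C_{uδ(ε)})_{uε}` and its closed version. -/
theorem stmt9 {X : Type*} [MetricSpace X] [ProperSpace X]
    (U : Set X) (hU : IsOpen U)
    (C V : Set X) (hC : C ⊆ U) (hV : V ⊆ U)
    (ε : ℝ) (hε0 : 0 < ε) (hε3 : ε < Real.log 3) :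
    C ∩ uEnl U V ε ⊆ uEnl U (V ∩ uEnl U C (deltaFn ε)) ε ∧
    (IsClosedIn U C → IsClosedIn U V →
      closureIn U (C ∩ uEnl U V ε) ⊆ uEnl U (closureIn U (uEnl U C (deltaFn ε) ∩ V)) ε) := by
  have h1 : C ∩ uEnl U V ε ⊆ uEnl U (V ∩ uEnl U C (deltaFn ε)) ε := by
    rintro x ⟨hxC, hxU, y, hyV, hd1, hd2⟩
    refine ⟨hxU, y, ⟨hyV, hV hyV, x, hxC, ?_, ?_⟩, hd1, hd2⟩
    · rw [dist_comm]; exact hd1.trans (delta_facts hε0 hε3).1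
    · obtain ⟨-, ha0, ha1, he⟩ := delta_facts hε0 hε3
      rw [he, dist_comm]
      have htri : Metric.infEDist y Uᶜ ≤ Metric.infEDist x Uᶜ + edist y x :=
        Metric.infEDist_le_infEDist_add_edist
      change _ ≤ Metric.infEDist y Uᶜ * _ at hd2
      change _ ≤ Metric.infEDist x Uᶜ * _
      generalize Real.exp (-ε) = a at *
      have hq : 0 < (1 - a) / (1 + a) := div_pos (by linarith) (by linarith)
      rcases eq_or_ne (Metric.infEDist x Uᶜ) ⊤ with ht | ht
      · rw [ht, ENNReal.top_mul (by simpa using hq)]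
        exact le_top
      · have ht' : Metric.infEDist y Uᶜ ≠ ⊤ :=
          ne_top_of_le_ne_top (ENNReal.add_ne_top.2 ⟨ht, edist_ne_top _ _⟩) htri
        rw [edist_dist, dist_comm] at htri
        lift Metric.infEDist x Uᶜ to NNReal using ht with p
        lift Metric.infEDist y Uᶜ to NNReal using ht' with q
        rw [← ENNReal.ofReal_coe_nnreal, ← ENNReal.ofReal_mul q.coe_nonneg,
          ENNReal.ofReal_le_ofReal_iff (mul_nonneg q.coe_nonneg (by linarith))] at hd2
        rw [← ENNReal.ofReal_coe_nnreal, ← ENNReal.ofReal_coe_nnreal,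
          ← ENNReal.ofReal_add p.coe_nonneg dist_nonneg,
          ENNReal.ofReal_le_ofReal_iff (add_nonneg p.coe_nonneg dist_nonneg)] at htri
        rw [← ENNReal.ofReal_coe_nnreal, ← ENNReal.ofReal_mul p.coe_nonneg]
        apply ENNReal.ofReal_le_ofReal
        rw [← mul_div_assoc, le_div_iff₀ (by linarith)]
        nlinarith [mul_le_mul_of_nonneg_right htri (by linarith : 0 ≤ 1 - a)]
  refine ⟨h1, fun _ _ => ?_⟩
  rw [inter_comm (uEnl U C (deltaFn ε)) V]
  exact (inter_subset_inter_left U (closure_mono h1)).trans (closure_uEnl_aux U _ ε)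
end

section
/- For all ε₁ > 0 and ε₂ > 0 with ε₂ ≤ e^{−ε₁}·ln(4)/9, and every subset C of U, one has (C_{uε₁})_{uε₂} ⊆ C_{u(ε₁ + 3e^{ε₁}ε₂)}. -/
open Set Metric

/-- iterated uniform enlargements: `(C_{uε₁})_{uε₂} ⊆ C_{u(ε₁+3e^{ε₁}ε₂)}` when
`ε₂ ≤ e^{−ε₁}·ln(4)/9`. -/
theorem stmt10 {X : Type*} [MetricSpace X]
    (U : Set X) (hU : IsOpen U) (C : Set X) (hC : C ⊆ U)
    (ε₁ ε₂ : ℝ) (h₁ : 0 < ε₁) (h₂ : 0 < ε₂)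
    (h : ε₂ ≤ Real.exp (-ε₁) * Real.log 4 / 9) :
    uEnl U (uEnl U C ε₁) ε₂ ⊆ uEnl U C (ε₁ + 3 * Real.exp ε₁ * ε₂) := by
  rintro x ⟨hxU, y, ⟨hyU, z, hz, hyz, hyz'⟩, hxy, hxy'⟩
  have hE : 1 ≤ Real.exp ε₁ := Real.one_le_exp h₁.le
  refine ⟨hxU, z, hz, ?_, ?_⟩
  · have := dist_triangle x y z
    nlinarith
  have key : (1 - Real.exp (-ε₁)) / 2 +
      (1 + (1 - Real.exp (-ε₁)) / 2) * ((1 - Real.exp (-ε₂)) / 2) ≤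
      (1 - Real.exp (-(ε₁ + 3 * Real.exp ε₁ * ε₂))) / 2 := by
    obtain ⟨t, ht⟩ : ∃ t, t = 3 * Real.exp ε₁ * ε₂ := ⟨_, rfl⟩
    have hs : 0 < Real.exp (-ε₁) := Real.exp_pos _
    have hsE : Real.exp (-ε₁) * Real.exp ε₁ = 1 := by
      rw [← Real.exp_add]; simp
    have hq : 1 - ε₂ ≤ Real.exp (-ε₂) := by
      have := Real.add_one_le_exp (-ε₂); linarith
    have hst : Real.exp (-ε₁) * t = 3 * ε₂ := by
      rw [ht]; linear_combination 3 * ε₂ * hsE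
    have hl : Real.log 4 ≤ 3 := by
      have := Real.log_le_sub_one_of_pos (show (0:ℝ) < 4 by norm_num)
      linarith
    have ht0 : 0 < t := by rw [ht]; positivity
    have ht1 : t ≤ 1 := by
      have : Real.exp (-ε₁) * t ≤ Real.exp (-ε₁) * 1 := by
        rw [hst]; nlinarith
      exact le_of_mul_le_mul_left this hs
    have het : Real.exp (-t) ≤ 1 - t / 2 := by
      have h3 : t + 1 ≤ Real.exp t := Real.add_one_le_exp t
      have h4 : Real.exp (-t) * Real.exp t = 1 := by
        rw [← Real.exp_add]; simp
      have h5 := Real.exp_pos (-t)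
      have h6 : Real.exp (-t) * (t + 1) ≤ 1 := by
        exact (mul_le_mul_of_nonneg_left h3 h5.le).trans h4.le
      have h7 : 1 ≤ (1 - t / 2) * (t + 1) := by nlinarith
      exact le_of_mul_le_mul_right (h6.trans h7) (by linarith)
    rw [← ht, neg_add, Real.exp_add]
    have h8 : Real.exp (-ε₁) * Real.exp (-t) ≤ Real.exp (-ε₁) * (1 - t / 2) := by gcongr
    have h9 : (3 - Real.exp (-ε₁)) * (1 - Real.exp (-ε₂)) ≤ 3 * ε₂ := by
      have : 0 ≤ 1 - Real.exp (-ε₂) := by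
        have := Real.exp_le_one_iff.2 (show -ε₂ ≤ 0 by linarith)
        linarith
      nlinarith
    nlinarith
  have ha : 0 ≤ (1 - Real.exp (-ε₁)) / 2 := by
    have := Real.exp_le_one_iff.2 (show -ε₁ ≤ 0 by linarith)
    linarith
  have hb : 0 ≤ (1 - Real.exp (-ε₂)) / 2 := by
    have := Real.exp_le_one_iff.2 (show -ε₂ ≤ 0 by linarith)
    linarith
  refine le_trans ?_ (mul_le_mul_right (ENNReal.ofReal_le_ofReal key) _)
  rw [ENNReal.ofReal_add ha (by positivity), ENNReal.ofReal_mul (by positivity),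
    ENNReal.ofReal_add zero_le_one ha, ENNReal.ofReal_one]
  generalize ENNReal.ofReal ((1 - Real.exp (-ε₁)) / 2) = A at *
  generalize ENNReal.ofReal ((1 - Real.exp (-ε₂)) / 2) = B at *
  rw [← edist_dist] at *
  have hy : Metric.infEDist y Uᶜ ≤ Metric.infEDist z Uᶜ + edist y z :=
    Metric.infEDist_le_infEDist_add_edist
  change edist x z ≤ Metric.infEDist z Uᶜ * _
  change edist x y ≤ Metric.infEDist y Uᶜ * _ at hxy'
  change edist y z ≤ Metric.infEDist z Uᶜ * _ at hyz'
  generalize Metric.infEDist z Uᶜ = D at *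
  calc edist x z ≤ edist x y + edist y z := edist_triangle _ _ _
    _ ≤ (D + D * A) * B + D * A := by
      gcongr
      refine hxy'.trans ?_
      gcongr
      refine hy.trans ?_
      gcongr
    _ = D * (A + (1 + A) * B) := by ring
end

section
/- Let (U_i)_{i∈I} and (V_j)_{j∈J} be two families of open subsets of U, each covering U, each member having compact closure contained in U, and with locally finite families of closures. If a family 𝓒 of closed subsets of U is stable under taking closed subsets and is enlargeable with respect to the cover (U_i)_{i∈I}, then 𝓒 is enlargeable with respect to the cover (V_j)_{j∈J}. -/
open Set Metric

theorem piece_closed {X : Type*} [MetricSpace X] (U K L : Set X) (hL : IsCompact L)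
    (hLU : L ⊆ U) (hK : IsCompact K) (ε : ℝ) : IsClosed (L ∩ uEnl U K ε) := by
  have hR : IsClosed {p : X × X | dist p.1 p.2 ≤ ε ∧
      ENNReal.ofReal (dist p.1 p.2) ≤
        EMetric.infEdist p.2 Uᶜ * ENNReal.ofReal ((1 - Real.exp (-ε)) / 2)} := by
    apply IsClosed.inter
    · exact isClosed_le continuous_dist continuous_const
    · refine isClosed_le (ENNReal.continuous_ofReal.comp continuous_dist) ?_
      exact (ENNReal.continuous_mul_const ENNReal.ofReal_ne_top).comp
        (Metric.continuous_infEDist.comp continuous_snd)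
  have hc := (((hL.prod hK).inter_right hR).image continuous_fst).isClosed
  convert hc using 1
  ext x
  constructor
  · rintro ⟨hx, _, y, hy, h1, h2⟩
    exact ⟨(x, y), ⟨⟨hx, hy⟩, h1, h2⟩, rfl⟩
  · rintro ⟨⟨x', y⟩, ⟨⟨hx, hy⟩, h1, h2⟩, rfl⟩
    exact ⟨hx, hLU hx, y, hy, h1, h2⟩

theorem coverEnl_closed {X : Type*} [MetricSpace X] {J : Type*}
    (U : Set X) (Vj : J → Set X) (hV : GoodCover Vj U) (C : Set X) (hC : IsClosedIn U C)
    (δ : J → ℝ) : IsClosedIn U (coverEnl Vj U C δ) := by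
  obtain ⟨F, hF, rfl⟩ := hC
  have hp : ∀ j, IsClosed (closure (Vj j) ∩ uEnl U (closure (Vj j) ∩ (F ∩ U)) (δ j)) := by
    intro j
    apply piece_closed _ _ _ (hV.compactCl j) (hV.clSubset j)
    have : closure (Vj j) ∩ (F ∩ U) = closure (Vj j) ∩ F := by
      ext x
      constructor
      · rintro ⟨h1, h2, _⟩
        exact ⟨h1, h2⟩
      · rintro ⟨h1, h2⟩
        exact ⟨h1, h2, hV.clSubset j h1⟩
    rw [this]
    exact (hV.compactCl j).inter_right hF
  refine ⟨_, isClosed_closure (s := coverEnl Vj U (F ∩ U) δ), ?_⟩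
  apply Subset.antisymm
  · intro x hx
    refine ⟨subset_closure hx, ?_⟩
    obtain ⟨j, hj⟩ := mem_iUnion.1 hx
    exact hV.clSubset j hj.1
  · rintro x ⟨hx, hxU⟩
    obtain ⟨t, ht, hfin⟩ := hV.locFin x hxU
    have hcl : IsClosed (⋃ j ∈ {j | (closure (Vj j) ∩ t).Nonempty},
        closure (Vj j) ∩ uEnl U (closure (Vj j) ∩ (F ∩ U)) (δ j)) :=
      hfin.isClosed_biUnion (fun j _ => hp j)
    have hmem : x ∈ closure (⋃ j ∈ {j | (closure (Vj j) ∩ t).Nonempty},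
        closure (Vj j) ∩ uEnl U (closure (Vj j) ∩ (F ∩ U)) (δ j)) := by
      rw [mem_closure_iff_nhds] at hx ⊢
      intro s hs
      obtain ⟨z, ⟨hzs, hzt⟩, hz⟩ := hx (s ∩ t) (Filter.inter_mem hs ht)
      obtain ⟨j, hj⟩ := mem_iUnion.1 hz
      exact ⟨z, hzs, mem_biUnion (show j ∈ {j | (closure (Vj j) ∩ t).Nonempty} from
        ⟨z, hj.1, hzt⟩) hj⟩
    rw [hcl.closure_eq] at hmem
    obtain ⟨j, _, hj⟩ := mem_iUnion₂.1 hmem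
    exact mem_iUnion.2 ⟨j, hj⟩

theorem local_enl {X : Type*} [MetricSpace X] {I : Type*}
    (U : Set X) (Ui : I → Set X) (hcov : GoodCover Ui U) (C : Set X)
    (ε : I → ℝ) (hε : ∀ i, 0 < ε i) (y : X) (hy : y ∈ U) :
    ∃ r > 0, ∃ δ > 0, ∀ z ∈ ball y r, z ∈ C → ∀ x, dist x z ≤ δ → x ∈ coverEnl Ui U C ε := by
  obtain ⟨i, hi⟩ := mem_iUnion.1 (hcov.covers hy)
  obtain ⟨R, hR, hb⟩ := Metric.isOpen_iff.1 (hcov.isOpen i) y hi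
  have hc : 0 < (1 - Real.exp (-ε i)) / 2 := by
    have : Real.exp (-ε i) < 1 := Real.exp_lt_one_iff.2 (by linarith [hε i])
    linarith
  set c := (1 - Real.exp (-ε i)) / 2 with hcdef
  refine ⟨R / 2, by positivity, min (R / 4) (min (ε i) (R / 2 * c)),
    by have := hε i; positivity, ?_⟩
  intro z hz hzC x hx
  have h1 := hx.trans (min_le_left _ _)
  have h2 := hx.trans ((min_le_right _ _).trans (min_le_left _ _))
  have h3 := hx.trans ((min_le_right _ _).trans (min_le_right _ _))
  rw [mem_ball] at hz
  have hxi : x ∈ Ui i := hb (by rw [mem_ball]; linarith [dist_triangle x z y])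
  have hzi : z ∈ Ui i := hb (by rw [mem_ball]; linarith)
  have hsub : closure (Ui i) ⊆ U := hcov.clSubset i
  refine mem_iUnion.2 ⟨i, subset_closure hxi, hsub (subset_closure hxi), z,
    ⟨subset_closure hzi, hzC⟩, h2, ?_⟩
  have hinf : ENNReal.ofReal (R / 2) ≤ Metric.infEDist z Uᶜ := by
    refine Metric.le_infEDist.2 ?_
    intro w hw
    rw [edist_dist]
    apply ENNReal.ofReal_le_ofReal
    by_contra hlt
    push Not at hlt
    apply hw
    apply hsub
    apply subset_closure
    apply hb
    rw [mem_ball]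
    linarith [dist_triangle w z y, dist_comm w z]
  calc ENNReal.ofReal (dist x z) ≤ ENNReal.ofReal (R / 2 * c) := ENNReal.ofReal_le_ofReal h3
    _ = ENNReal.ofReal (R / 2) * ENNReal.ofReal c := ENNReal.ofReal_mul (by positivity)
    _ ≤ _ := mul_le_mul_left hinf _

/-- enlargeability of a subset-stable family does not depend on the chosen
cover. -/
theorem stmt14 {X : Type*} [MetricSpace X] [ProperSpace X] {I J : Type*}
    (U : Set X) (hU : IsOpen U)
    (Ui : I → Set X) (hcovU : GoodCover Ui U)
    (Vj : J → Set X) (hcovV : GoodCover Vj U)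
    (𝓒 : Set (Set X)) (hcl : ∀ C ∈ 𝓒, IsClosedIn U C)
    (hstab : ∀ F C, C ∈ 𝓒 → IsClosedIn U F → F ⊆ C → F ∈ 𝓒)
    (hen : Enlargeable Ui U 𝓒) :
    Enlargeable Vj U 𝓒 := by
  intro C hC
  obtain ⟨ε, hε, hCε⟩ := hen C hC
  have key : ∀ j, ∃ δ > 0, ∀ z ∈ closure (Vj j), z ∈ C → ∀ x, dist x z ≤ δ →
      x ∈ coverEnl Ui U C ε := by
    intro j
    refine (hcovV.compactCl j).induction_on
      (p := fun S => ∃ δ > 0, ∀ z ∈ S, z ∈ C → ∀ x, dist x z ≤ δ → x ∈ coverEnl Ui U C ε)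
      ⟨1, one_pos, by simp⟩ ?_ ?_ ?_
    · rintro s t hst ⟨δ, hδ, h⟩
      exact ⟨δ, hδ, fun z hz => h z (hst hz)⟩
    · rintro s t ⟨δ, hδ, h⟩ ⟨δ', hδ', h'⟩
      refine ⟨min δ δ', lt_min hδ hδ', ?_⟩
      rintro z (hz | hz) hzC x hx
      · exact h z hz hzC x (hx.trans (min_le_left _ _))
      · exact h' z hz hzC x (hx.trans (min_le_right _ _))
    · intro y hy
      obtain ⟨r, hr, δ, hδ, h⟩ := local_enl U Ui hcovU C ε hε y (hcovV.clSubset j hy)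
      exact ⟨ball y r, mem_nhdsWithin_of_mem_nhds (ball_mem_nhds y hr), δ, hδ, h⟩
  choose δ hδ h using key
  refine ⟨δ, hδ, hstab _ _ hCε (coverEnl_closed U Vj hcovV C (hcl C hC) δ) ?_⟩
  intro x hx
  obtain ⟨j, _, _, y, hy, hd, _⟩ := mem_iUnion.1 hx
  exact h j y hy.1 hy.2 x hd
end
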